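/- arXiv:0806.4333 — 2 statements merged into one kernel-verified Lean document; each statement's English description precedes it below -/
import Mathlib

section
/- Let {a_i}_{0 ≤ i ≤ m} be a sequence of positive real numbers that is ratio monotone, i.e., a_0/a_{m-1} ≤ a_1/a_{m-2} ≤ ⋯ ≤ a_{⌊m/2⌋-1}/a_{m-⌊m/2⌋} ≤ 1 and a_m/a_0 ≤ a_{m-1}/a_1 ≤ ⋯ ≤ a_{m-⌊(m-1)/2⌋}/a_{⌊(m-1)/2⌋} ≤ 1. Then the sequence is log-concave: a_i^2 ≥ a_{i-1}·a_{i+1} for all 1 ≤ i ≤ m-1. -/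
/-- Multiplying `x * u ≤ y * v` and `v * z ≤ y * u` and cancelling `u * v` gives `x * z ≤ y ^ 2`. -/
lemma mul_le_sq_of_cross_mul_le {x y z u v : ℝ} (hy : 0 < y) (hz : 0 < z) (hu : 0 < u)
    (hv : 0 < v) (h : x * u ≤ y * v) (h' : v * z ≤ y * u) : x * z ≤ y ^ 2 := by
  refine le_of_mul_le_mul_right ?_ (mul_pos hu hv)
  calc x * z * (u * v) = x * u * (v * z) := by ring
    _ ≤ y * v * (y * u) := mul_le_mul h h' (mul_pos hv hz).le (mul_pos hy hv).le
    _ = y ^ 2 * (u * v) := by ring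

theorem ratio_monotone_implies_log_concave (m : ℕ) (a : ℕ → ℝ)
    (hpos : ∀ i : ℕ, i ≤ m → 0 < a i)
    (h1 : ∀ i : ℕ, 1 ≤ i → i + 1 ≤ m / 2 →
      a (i - 1) / a (m - i) ≤ a i / a (m - 1 - i))
    (h2 : a (m / 2 - 1) / a (m - m / 2) ≤ 1)
    (h3 : ∀ i : ℕ, i + 1 ≤ (m - 1) / 2 →
      a (m - i) / a i ≤ a (m - 1 - i) / a (i + 1))
    (h4 : a (m - (m - 1) / 2) / a ((m - 1) / 2) ≤ 1) :
    ∀ i : ℕ, 1 ≤ i → i ≤ m - 1 → a (i - 1) * a (i + 1) ≤ a i ^ 2 := by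
  intro i hi him
  have low : ∀ j k l p : ℕ, j + 1 = k → k + 1 ≤ m / 2 → l + k = m → p + k + 1 = m →
      a j * a p ≤ a k * a l := by
    intro j k l p hj hk hl hp
    have h := h1 k (by omega) hk
    rw [show k - 1 = j by omega, show m - k = l by omega, show m - 1 - k = p by omega,
      div_le_div_iff₀ (hpos l (by omega)) (hpos p (by omega))] at h
    exact h
  have high : ∀ j k l p : ℕ, j + 1 = k → k ≤ (m - 1) / 2 → l + j = m → p + k = m →
      a l * a k ≤ a p * a j := by
    intro j k l p hj hk hl hp
    have h := h3 j (by omega)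
    rw [show m - j = l by omega, show m - 1 - j = p by omega, hj,
      div_le_div_iff₀ (hpos j (by omega)) (hpos k (by omega))] at h
    exact h
  rw [div_le_one (hpos _ (by omega))] at h2 h4
  have p0 := hpos (i - 1) (by omega)
  have p1 := hpos i (by omega)
  have p2 := hpos (i + 1) (by omega)
  by_cases c1 : i + 1 ≤ (m - 1) / 2
  · have e1 := low (i - 1) i (m - i) (m - i - 1) (by omega) (by omega) (by omega) (by omega)
    have e2 := high i (i + 1) (m - i) (m - i - 1) rfl c1 (by omega) (by omega)
    exact mul_le_sq_of_cross_mul_le p1 p2 (hpos _ (by omega)) (hpos _ (by omega)) e1 (by linarith)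
  by_cases c2 : m - i + 1 ≤ m / 2
  · have e1 := low (m - i - 1) (m - i) i (i - 1) (by omega) c2 (by omega) (by omega)
    have e2 := high (m - i - 1) (m - i) (i + 1) i (by omega) (by omega) (by omega) (by omega)
    exact mul_le_sq_of_cross_mul_le p1 p2 (hpos (m - i - 1) (by omega)) (hpos (m - i) (by omega))
      (by linarith) (by linarith)
  obtain ⟨n, rfl | rfl⟩ := Nat.even_or_odd' m
  · rw [show 2 * n / 2 = n by omega, show 2 * n - n = n by omega] at h2
    rw [show (2 * n - 1) / 2 = n - 1 by omega, show 2 * n - (n - 1) = n + 1 by omega] at h4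
    obtain rfl | rfl : i = n ∨ n = i + 1 := by omega
    · nlinarith
    · have e := low (i - 1) i (i + 2) (i + 1) (by omega) (by omega) (by omega) (by omega)
      simp only [Nat.add_sub_cancel] at h4
      nlinarith
  · rw [show (2 * n + 1) / 2 = n by omega, show 2 * n + 1 - n = n + 1 by omega] at h2
    rw [show (2 * n + 1 - 1) / 2 = n by omega, show 2 * n + 1 - n = n + 1 by omega] at h4
    obtain rfl | rfl : i = n ∨ i = n + 1 := by omega
    · nlinarith
    · have e := high (n - 1) n (n + 2) (n + 1) (by omega) (by omega) (by omega) (by omega)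
      simp only [Nat.add_sub_cancel] at p0 ⊢
      nlinarith
end

section
/- Let m be a positive integer. Then for every integer i with 0 ≤ i ≤ m/2, the following inequality of rational functions holds: 2(2m-i) / (2(m+1)B(m,m-i) − (6m-2i+3)) > (2(m+1)B(m,i) − (4m+2i+3)) / (2(m+i)), where B(m,i) = A(m,i) / (2(i+2)(4m+2i+5)(m+1)(m-i+1)) and A(m,i) = 30 + 96m² + 94m + 37i + 72m²i + 8m²i² − i³ + 99mi + 5i² + 13mi² + 16m³i + 32m³ (in particular, the denominator 2(m+1)B(m,m-i) − (6m-2i+3) is positive in this range when 1 ≤ i). -/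
/-- The polynomial `A(m,i)` from Kauers–Paule's bound. -/
noncomputable def A (m i : ℕ) : ℝ :=
  (30 : ℝ) + 96 * (m : ℝ) ^ 2 + 94 * (m : ℝ) + 37 * (i : ℝ)
    + 72 * (m : ℝ) ^ 2 * (i : ℝ) + 8 * (m : ℝ) ^ 2 * (i : ℝ) ^ 2 - (i : ℝ) ^ 3
    + 99 * (m : ℝ) * (i : ℝ) + 5 * (i : ℝ) ^ 2 + 13 * (m : ℝ) * (i : ℝ) ^ 2
    + 16 * (m : ℝ) ^ 3 * (i : ℝ) + 32 * (m : ℝ) ^ 3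

/-- The bound `B(m,i) = A(m,i) / (2(i+2)(4m+2i+5)(m+1)(m-i+1))`. -/
noncomputable def B (m i : ℕ) : ℝ :=
  A m i / (2 * ((i : ℝ) + 2) * (4 * (m : ℝ) + 2 * (i : ℝ) + 5) * ((m : ℝ) + 1)
    * ((m : ℝ) - (i : ℝ) + 1))

/-- The common denominator of `2(m+1)B(m,j) - (4m+2j+3)`. -/
noncomputable def boundDen (m j : ℝ) : ℝ := (j + 2) * (4 * m + 2 * j + 5) * (m - j + 1)

/-- The numerator of `2(m+1)B(m,j) - (4m+2j+3)` over `boundDen m j`. -/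
noncomputable def boundNum (m j : ℝ) : ℝ :=
  20 * j + 24 * m ^ 2 * j + 8 * m ^ 2 * j ^ 2 + 19 * j ^ 3 + 52 * m * j + 28 * j ^ 2
    + 37 * m * j ^ 2 + 12 * m * j ^ 3 + 4 * j ^ 4

lemma boundDen_pos (m j : ℝ) (hj : 0 ≤ j) (hjm : j ≤ m) : 0 < boundDen m j := by
  have h : 0 < m - j + 1 := by linarith
  have hm : 0 ≤ m := hj.trans hjm
  unfold boundDen
  positivity

lemma boundNum_pos (m j : ℝ) (hm : 0 ≤ m) (hj : 0 < j) : 0 < boundNum m j := by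
  unfold boundNum
  positivity

lemma two_mul_succ_mul_B_sub (m j : ℕ) (hjm : j ≤ m) :
    2 * ((m : ℝ) + 1) * B m j - (4 * (m : ℝ) + 2 * (j : ℝ) + 3) =
      boundNum m j / boundDen m j := by
  have hjm' : (j : ℝ) ≤ m := by exact_mod_cast hjm
  have h : (m : ℝ) - j + 1 ≠ 0 := by linarith
  have h2 : (j : ℝ) + 2 ≠ 0 := by positivity
  have h3 : 4 * (m : ℝ) + 2 * j + 5 ≠ 0 := by positivity
  have h4 : (m : ℝ) + 1 ≠ 0 := by positivity
  unfold B A boundNum boundDen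
  field_simp
  ring

lemma boundNum_mul_boundNum_lt (m i : ℝ) (hm : 0 < m) (hi : 0 ≤ i) (him : 2 * i ≤ m) :
    boundNum m i * boundNum m (m - i) <
      4 * (2 * m - i) * (m + i) * (boundDen m (m - i) * boundDen m i) := by
  obtain ⟨k, rfl⟩ : ∃ k, m = 2 * i + k := ⟨m - 2 * i, by ring⟩
  have hk : 0 ≤ k := by linarith
  rw [← sub_pos]
  have key : 4 * (2 * (2 * i + k) - i) * (2 * i + k + i) *
        (boundDen (2 * i + k) (2 * i + k - i) * boundDen (2 * i + k) i) -
      boundNum (2 * i + k) i * boundNum (2 * i + k) (2 * i + k - i) =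
        2520 * i ^ 7 + 8820 * i ^ 6 * k + 17739 * i ^ 6 + 11964 * i ^ 5 * k ^ 2 +
        53217 * i ^ 5 * k + 43104 * i ^ 5 + 7860 * i ^ 4 * k ^ 3 + 66921 * i ^ 4 * k ^ 2 +
        107760 * i ^ 4 * k + 44316 * i ^ 4 + 2508 * i ^ 3 * k ^ 4 + 45147 * i ^ 3 * k ^ 3 +
        111856 * i ^ 3 * k ^ 2 + 88632 * i ^ 3 * k + 19920 * i ^ 3 + 312 * i ^ 2 * k ^ 5 +
        17560 * i ^ 2 * k ^ 4 + 60024 * i ^ 2 * k ^ 3 + 69532 * i ^ 2 * k ^ 2 + 29880 * i ^ 2 * k +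
        3200 * i ^ 2 + 3856 * i * k ^ 5 + 16728 * i * k ^ 4 + 25216 * i * k ^ 3 +
        15560 * i * k ^ 2 + 3200 * i * k + 384 * k ^ 6 + 1952 * k ^ 5 +
        3568 * k ^ 4 + 2800 * k ^ 3 + 800 * k ^ 2 := by
    unfold boundNum boundDen
    ring
  rw [key]
  rcases hi.eq_or_lt with rfl | hi
  · have hk' : 0 < k := by linarith
    positivity
  · positivity

theorem B_rational_inequality (m i : ℕ) (hm : 1 ≤ m) (hi : 2 * i ≤ m) :
    2 * (2 * (m : ℝ) - (i : ℝ)) /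
        (2 * ((m : ℝ) + 1) * B m (m - i) - (6 * (m : ℝ) - 2 * (i : ℝ) + 3)) >
      (2 * ((m : ℝ) + 1) * B m i - (4 * (m : ℝ) + 2 * (i : ℝ) + 3)) /
        (2 * ((m : ℝ) + (i : ℝ))) ∧
    (1 ≤ i →
      0 < 2 * ((m : ℝ) + 1) * B m (m - i) - (6 * (m : ℝ) - 2 * (i : ℝ) + 3)) := by
  have him : i ≤ m := by omega
  have hm0 : (0 : ℝ) < m := by exact_mod_cast hm
  have hi0 : (0 : ℝ) ≤ i := i.cast_nonneg
  have hi2 : 2 * (i : ℝ) ≤ m := by exact_mod_cast hi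
  have hmi : 0 < (m : ℝ) - i := by linarith
  have hcompl : 2 * ((m : ℝ) + 1) * B m (m - i) - (6 * (m : ℝ) - 2 * (i : ℝ) + 3) =
      boundNum m (m - i) / boundDen m (m - i) := by
    have h := two_mul_succ_mul_B_sub m (m - i) (Nat.sub_le m i)
    rw [Nat.cast_sub him] at h
    rw [← h]
    ring
  have hden : 0 < boundDen m i := boundDen_pos m i hi0 (by linarith)
  have hden' : 0 < boundDen m (m - i) := boundDen_pos m (m - i) hmi.le (by linarith)
  have hnum' : 0 < boundNum m (m - i) := boundNum_pos m (m - i) hm0.le hmi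
  rw [hcompl, two_mul_succ_mul_B_sub m i him]
  refine ⟨?_, fun _ => div_pos hnum' hden'⟩
  rw [gt_iff_lt, div_lt_div_iff₀ (by positivity) (div_pos hnum' hden'), div_mul_div_comm,
    div_lt_iff₀ (by positivity)]
  linarith [boundNum_mul_boundNum_lt m i hm0 hi0 hi2]
end
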